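/- Let A and B be coaugmented chain coalgebras over a commutative ring R. The natural homotopy h on Ω(A⊗B) satisfies the side conditions qh = 0, hσ = 0, and h² = 0, where q is the Milgram map and σ its natural section. -/

import Mathlib

open scoped TensorProduct
open DirectSum

noncomputable section
namespace CJ2

/-- Cast along an equality of indices in a graded module. -/
def pcast {R : Type} [CommRing R] {A : ℕ → Type} [∀ n, AddCommGroup (A n)]
    [∀ n, Module R (A n)] {m n : ℕ} (h : m = n) : A m →ₗ[R] A n where
  toFun x := h ▸ x
  map_add' := by subst h; intros; rfl
  map_smul' := by subst h; intros; rfl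

/-- A coaugmented chain coalgebra over `R`, presented componentwise: a non-negatively
graded `R`-module `A` with differential `d` of degree `-1`, comultiplication given by
its components `comul p q : A (p+q) → A p ⊗ A q`, counit and coaugmentation, subject to
the usual axioms (coassociativity, counit laws, co-Leibniz rule, `d² = 0`). -/
structure CoalgStr (R : Type) [CommRing R] (A : ℕ → Type)
    [∀ n, AddCommGroup (A n)] [∀ n, Module R (A n)] where
  d : ∀ n, A (n+1) →ₗ[R] A n
  dd : ∀ (n : ℕ) (x : A (n+2)), d n (d (n+1) x) = 0
  comul : ∀ p q, A (p+q) →ₗ[R] (A p ⊗[R] A q)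
  counit : A 0 →ₗ[R] R
  coaug : R →ₗ[R] A 0
  counit_coaug : counit (coaug 1) = 1
  coaug_grouplike : comul 0 0 (coaug 1) = coaug 1 ⊗ₜ[R] coaug 1
  comul_counit : ∀ (n : ℕ) (x : A n),
    TensorProduct.rid R (A n) ((TensorProduct.map LinearMap.id counit) (comul n 0 x)) = x
  counit_comul : ∀ (n : ℕ) (x : A n),
    TensorProduct.lid R (A n) ((TensorProduct.map counit LinearMap.id)
      (comul 0 n (pcast (R := R) (A := A) (Nat.zero_add n).symm x))) = x
  coassoc : ∀ (p q r : ℕ) (x : A (p+q+r)),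
    TensorProduct.assoc R (A p) (A q) (A r)
        ((TensorProduct.map (comul p q) LinearMap.id) (comul (p+q) r x))
      = (TensorProduct.map LinearMap.id (comul q r)) (comul p (q+r) (pcast (R := R) (A := A) (Nat.add_assoc p q r) x))
  coleib : ∀ (p q : ℕ) (x : A (p+q+1)),
    comul p q (d (p+q) x)
      = (TensorProduct.map (d p) LinearMap.id) (comul (p+1) q (pcast (R := R) (A := A) (by omega) x))
        + ((-1 : ℤ)^p) • (TensorProduct.map LinearMap.id (d q)) (comul p (q+1) (pcast (R := R) (A := A) (by omega) x))
  counit_d : ∀ x : A 1, counit (d 0 x) = 0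

section Setup

variable {R : Type} [CommRing R]
variable (A : ℕ → Type) [∀ n, AddCommGroup (A n)] [∀ n, Module R (A n)] (CA : CoalgStr R A)

/-- The reduced part `Ā` of a coaugmented chain coalgebra:
`ker ε` in degree 0, everything in positive degree. -/
def redT : ℕ → Type
  | 0 => ↥(LinearMap.ker CA.counit)
  | n+1 => A (n+1)

instance redT.acg : ∀ n, AddCommGroup (redT A CA n)
  | 0 => inferInstanceAs (AddCommGroup ↥(LinearMap.ker CA.counit))
  | n+1 => inferInstanceAs (AddCommGroup (A (n+1)))

instance redT.mod : ∀ n, Module R (redT A CA n)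
  | 0 => inferInstanceAs (Module R ↥(LinearMap.ker CA.counit))
  | n+1 => inferInstanceAs (Module R (A (n+1)))

/-- The total module of the reduced coalgebra `Ā`. -/
abbrev Big := ⨁ n, redT A CA n

/-- Reduction `A n → Ā n`: in degree 0 it kills the coaugmentation
(`x ↦ x - η(ε x)`), in positive degrees the identity. -/
def toRed : ∀ n, A n →ₗ[R] redT A CA n
  | 0 => LinearMap.codRestrict (LinearMap.ker CA.counit)
      (LinearMap.id - CA.coaug ∘ₗ CA.counit)
      (fun x => by
        have h1 : CA.coaug (CA.counit x) = CA.counit x • CA.coaug 1 := by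
          rw [← map_smul, smul_eq_mul, mul_one]
        simp only [LinearMap.mem_ker, LinearMap.sub_apply, LinearMap.id_apply,
          LinearMap.coe_comp, Function.comp_apply, map_sub, h1, map_smul,
          CA.counit_coaug, smul_eq_mul, mul_one, sub_self])
  | n+1 => LinearMap.id

/-- The embedding of a homogeneous component of `A` into `Ā`
(killing the coaugmentation in degree 0). -/
def embT (n : ℕ) : A n →ₗ[R] Big A CA :=
  (DirectSum.lof R ℕ (redT A CA) n).comp (toRed A CA n)

/-- The degree-0 "counit" of the component `A q` (the counit for `q = 0`, else `0`). -/
def epsAt : ∀ q, A q →ₗ[R] R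
  | 0 => CA.counit
  | _+1 => 0

/-- The value of the reduced diagonal `Δ̄` on a homogeneous element,
as an element of `Ā ⊗ Ā` (the embeddings kill the primitive terms). -/
def bigDiag (p : ℕ) : A p →ₗ[R] (Big A CA ⊗[R] Big A CA) :=
  ∑ j : Fin (p+1),
    (TensorProduct.map (embT A CA j.1) (embT A CA (p - j.1))).comp
      ((CA.comul j.1 (p - j.1)).comp (pcast (R := R) (A := A) (by have := j.is_le; omega)))

end Setup

section TwoCoalgebras

variable {R : Type} [CommRing R]
variable (A : ℕ → Type) [∀ n, AddCommGroup (A n)] [∀ n, Module R (A n)] (CA : CoalgStr R A)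
variable (B : ℕ → Type) [∀ n, AddCommGroup (B n)] [∀ n, Module R (B n)] (CB : CoalgStr R B)

/-- The module of generators of `Ω (A ⊗ B)`: the reduced part
`(A ⊗ B)‾ = (Ā ⊗ B̄) ⊕ Ā ⊕ B̄`. -/
abbrev WW := (Big A CA ⊗[R] Big B CB) × Big A CA × Big B CB

/-- The underlying algebra of the cobar construction `Ω (A ⊗ B)`. -/
abbrev Om := TensorAlgebra R (WW A CA B CB)

/-- The underlying algebra of `Ω A`. -/
abbrev OmA := TensorAlgebra R (Big A CA)

/-- The underlying algebra of `Ω B`. -/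
abbrev OmB := TensorAlgebra R (Big B CB)

/-- The letter `[a]`, `a ∈ Ā`. -/
def lA : Big A CA →ₗ[R] WW A CA B CB := LinearMap.prod 0 (LinearMap.prod LinearMap.id 0)

/-- The letter `[b]`, `b ∈ B̄`. -/
def lB : Big B CB →ₗ[R] WW A CA B CB := LinearMap.prod 0 (LinearMap.prod 0 LinearMap.id)

/-- The letter `[ab]`, `a ∈ Ā`, `b ∈ B̄`. -/
def lT : (Big A CA ⊗[R] Big B CB) →ₗ[R] WW A CA B CB := LinearMap.prod LinearMap.id 0

/-- The length-one word `[a]` in `Ω (A ⊗ B)`. -/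
def genA (x : Big A CA) : Om A CA B CB := TensorAlgebra.ι R (lA A CA B CB x)

/-- The length-one word `[b]` in `Ω (A ⊗ B)`. -/
def genB (y : Big B CB) : Om A CA B CB := TensorAlgebra.ι R (lB A CA B CB y)

/-- The length-one word `[ab]` in `Ω (A ⊗ B)`. -/
def genT (t : Big A CA ⊗[R] Big B CB) : Om A CA B CB := TensorAlgebra.ι R (lT A CA B CB t)

/-- The generator of `Ω(A⊗B)` corresponding to a homogeneous element of `A_p ⊗ B_q`
(decomposed into its `[āb̄]`, `[ā]`, `[b̄]` parts). -/
def Γg (p q : ℕ) : (A p ⊗[R] B q) →ₗ[R] WW A CA B CB :=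
  LinearMap.prod (TensorProduct.map (embT A CA p) (embT B CB q))
    (LinearMap.prod
      ((embT A CA p).comp ((TensorProduct.rid R (A p)).toLinearMap.comp
        (TensorProduct.map LinearMap.id (epsAt B CB q))))
      ((embT B CB q).comp ((TensorProduct.lid R (B q)).toLinearMap.comp
        (TensorProduct.map (epsAt A CA p) LinearMap.id))))

/-- The length-one word of `Ω (A ⊗ B)` on a homogeneous element of `A_p ⊗ B_q`. -/
def genW (p q : ℕ) (z : A p ⊗[R] B q) : Om A CA B CB :=
  TensorAlgebra.ι R (Γg A CA B CB p q z)

/-- The generator values of the Milgram map: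
`[a ⊗ 1] ↦ [a] ⊗ [ ]`, `[1 ⊗ b] ↦ [ ] ⊗ [b]`, `[a ⊗ b] ↦ 0`. -/
def qgen : WW A CA B CB →ₗ[R] (OmA A CA ⊗[R] OmB B CB) :=
  ((TensorProduct.mk R (OmA A CA) (OmB B CB)).flip 1).comp
      ((TensorAlgebra.ι R).comp
        ((LinearMap.fst R (Big A CA) (Big B CB)).comp
          (LinearMap.snd R (Big A CA ⊗[R] Big B CB) (Big A CA × Big B CB))))
  + (TensorProduct.mk R (OmA A CA) (OmB B CB) 1).comp
      ((TensorAlgebra.ι R).comp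
        ((LinearMap.snd R (Big A CA) (Big B CB)).comp
          (LinearMap.snd R (Big A CA ⊗[R] Big B CB) (Big A CA × Big B CB))))

/-- The Milgram map `q : Ω (A ⊗ B) → Ω A ⊗ Ω B`. -/
def qMil : Om A CA B CB →ₐ[R] (OmA A CA ⊗[R] OmB B CB) :=
  TensorAlgebra.lift R (qgen A CA B CB)

/-- `Ω i_A : Ω A → Ω (A ⊗ B)`. -/
def OiA : OmA A CA →ₐ[R] Om A CA B CB :=
  TensorAlgebra.lift R ((TensorAlgebra.ι R).comp (lA A CA B CB))

/-- `Ω i_B : Ω B → Ω (A ⊗ B)`. -/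
def OiB : OmB B CB →ₐ[R] Om A CA B CB :=
  TensorAlgebra.lift R ((TensorAlgebra.ι R).comp (lB A CA B CB))

/-- The natural section `σ : Ω A ⊗ Ω B → Ω (A ⊗ B)`,
`σ (u ⊗ v) = Ω i_A (u) · Ω i_B (v)`. -/
def sigmaMil : (OmA A CA ⊗[R] OmB B CB) →ₗ[R] Om A CA B CB :=
  TensorProduct.lift ((LinearMap.mul R (Om A CA B CB)).compl₁₂
    (OiA A CA B CB).toLinearMap (OiB A CA B CB).toLinearMap)

/-- Bilinear multiplication helper: `(m ⊗ n) ↦ f m * g n`. -/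
def mul2 {M N P : Type} [AddCommGroup M] [Module R M] [AddCommGroup N] [Module R N]
    [Ring P] [Algebra R P] (f : M →ₗ[R] P) (g : N →ₗ[R] P) : (M ⊗[R] N) →ₗ[R] P :=
  TensorProduct.lift ((LinearMap.mul R P).compl₁₂ f g)

/-- The word in `Ω (A ⊗ B)` given by a list of homogeneous letters from `Ā`. -/
def wordA (l : List ((p : ℕ) × A p)) : Om A CA B CB :=
  (l.map fun t => genA A CA B CB (embT A CA t.1 t.2)).prod

/-- The word in `Ω (A ⊗ B)` given by a list of homogeneous letters from `B̄`. -/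
def wordB (l : List ((q : ℕ) × B q)) : Om A CA B CB :=
  (l.map fun t => genB A CA B CB (embT B CB t.1 t.2)).prod

/-- The word in `Ω (A ⊗ B)` given by a list of general homogeneous letters. -/
def wordW (l : List ((pq : ℕ × ℕ) × (A pq.1 ⊗[R] B pq.2))) : Om A CA B CB :=
  (l.map fun t => genW A CA B CB t.1.1 t.1.2 t.2).prod

/-- Parity of the cobar degree of a word of `Ā`-letters. -/
def degA (l : List ((p : ℕ) × A p)) : ℕ := (l.map fun t => t.1).sum + l.length

/-- Parity of the cobar degree of a word of general letters. -/
def degW (l : List ((pq : ℕ × ℕ) × (A pq.1 ⊗[R] B pq.2))) : ℕ :=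
  (l.map fun t => t.1.1 + t.1.2).sum + l.length

/-- The Sweedler-type operation `(b₁ ⊗ b₂) ↦ h([b₁ | α]) · [a b₂]`. -/
def sweedC (h : Om A CA B CB →ₗ[R] Om A CA B CB) (α : List ((p : ℕ) × A p))
    (x : Big A CA) : (Big B CB ⊗[R] Big B CB) →ₗ[R] Om A CA B CB :=
  TensorProduct.lift ((LinearMap.mul R (Om A CA B CB)).compl₁₂
    (h ∘ₗ (LinearMap.mulRight R (wordA A CA B CB α)) ∘ₗ (TensorAlgebra.ι R) ∘ₗ lB A CA B CB)
    ((TensorAlgebra.ι R) ∘ₗ (lT A CA B CB) ∘ₗ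
      (TensorProduct.mk R (Big A CA) (Big B CB) x)))

/-- The Sweedler-type operation `(b₁ ⊗ b₂) ↦ [a b₁] · h([b₂ | α])`. -/
def sweedC2 (h : Om A CA B CB →ₗ[R] Om A CA B CB) (α : List ((p : ℕ) × A p))
    (x : Big A CA) : (Big B CB ⊗[R] Big B CB) →ₗ[R] Om A CA B CB :=
  TensorProduct.lift ((LinearMap.mul R (Om A CA B CB)).compl₁₂
    ((TensorAlgebra.ι R) ∘ₗ (lT A CA B CB) ∘ₗ
      (TensorProduct.mk R (Big A CA) (Big B CB) x))
    (h ∘ₗ (LinearMap.mulRight R (wordA A CA B CB α)) ∘ₗ (TensorAlgebra.ι R) ∘ₗ lB A CA B CB))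

end TwoCoalgebras

section CobarValues

variable {R : Type} [CommRing R]
variable (A : ℕ → Type) [∀ n, AddCommGroup (A n)] [∀ n, Module R (A n)] (CA : CoalgStr R A)

/-- The linear part `[dx]` of the cobar differential of `Ω A` on a generator. -/
def linAA : ∀ p, A p →ₗ[R] OmA A CA
  | 0 => 0
  | p+1 => (TensorAlgebra.ι R).comp ((embT A CA p).comp (CA.d p))

/-- The quadratic part `∑ (-1)^{deg x₍₁₎} [x₍₁₎|x₍₂₎]` of the cobar differential of
`Ω A` on a generator. -/
def quadAA (p : ℕ) : A p →ₗ[R] OmA A CA :=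
  ∑ j : Fin (p+1), ((-1 : ℤ)^(j.1)) •
    ((mul2 (TensorAlgebra.ι R) (TensorAlgebra.ι R)).comp
      ((TensorProduct.map (embT A CA j.1) (embT A CA (p - j.1))).comp
        ((CA.comul j.1 (p - j.1)).comp (pcast (R := R) (A := A) (by have := j.is_le; omega)))))

/-- The value of the cobar differential of `Ω A` on the generator given by a homogeneous
element: `d_Ω [x] = -[dx] + ∑ (-1)^{deg x₍₁₎} [x₍₁₎|x₍₂₎]`. -/
def dvalAA (p : ℕ) : A p →ₗ[R] OmA A CA := - linAA A CA p + quadAA A CA p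

/-- The word of `Ω A` given by a list of homogeneous letters. -/
def wordAlg (l : List ((p : ℕ) × A p)) : OmA A CA :=
  (l.map fun t => TensorAlgebra.ι R (embT A CA t.1 t.2)).prod

end CobarValues

section CobarValuesT

variable {R : Type} [CommRing R]
variable (A : ℕ → Type) [∀ n, AddCommGroup (A n)] [∀ n, Module R (A n)] (CA : CoalgStr R A)
variable (B : ℕ → Type) [∀ n, AddCommGroup (B n)] [∀ n, Module R (B n)] (CB : CoalgStr R B)

/-- `[(da) b]` : the `A`-part of the linear term of the cobar differential of
`Ω (A ⊗ B)` on a generator of bidegree `(p,q)`. -/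
def linT1 : ∀ (p q : ℕ), (A p ⊗[R] B q) →ₗ[R] Om A CA B CB
  | 0, _ => 0
  | p+1, q => ((TensorAlgebra.ι R).comp (Γg A CA B CB p q)).comp
      (TensorProduct.map (CA.d p) LinearMap.id)

/-- `(-1)^p [a (db)]` : the `B`-part of the linear term. -/
def linT2 : ∀ (p q : ℕ), (A p ⊗[R] B q) →ₗ[R] Om A CA B CB
  | _, 0 => 0
  | p, q+1 => ((-1 : ℤ)^p) • (((TensorAlgebra.ι R).comp (Γg A CA B CB p q)).comp
      (TensorProduct.map LinearMap.id (CB.d q)))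

/-- The quadratic (Künneth) part of the cobar differential of `Ω (A ⊗ B)` on a
generator of bidegree `(p,q)`:
`∑ (-1)^{q₁p₂} (-1)^{p₁+q₁} [a₍₁₎b₍₁₎ | a₍₂₎b₍₂₎]` (primitive terms being killed by
the reduction embeddings). -/
def quadT (p q : ℕ) : (A p ⊗[R] B q) →ₗ[R] Om A CA B CB :=
  ∑ j : Fin (p+1), ∑ k : Fin (q+1),
    ((-1 : ℤ)^(k.1 * (p - j.1) + j.1 + k.1)) •
      ((mul2 ((TensorAlgebra.ι R).comp (Γg A CA B CB j.1 k.1))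
             ((TensorAlgebra.ι R).comp (Γg A CA B CB (p - j.1) (q - k.1)))).comp
        ((TensorProduct.tensorTensorTensorComm R (A j.1) (A (p - j.1)) (B k.1) (B (q - k.1))).toLinearMap.comp
          (TensorProduct.map
            ((CA.comul j.1 (p - j.1)).comp (pcast (R := R) (A := A) (by have := j.is_le; omega)))
            ((CB.comul k.1 (q - k.1)).comp (pcast (R := R) (A := B) (by have := k.is_le; omega))))))

/-- The value of the cobar differential of `Ω (A ⊗ B)` on the generator given by a
homogeneous element of `A_p ⊗ B_q`:
`d_Ω [w] = -[d_{A⊗B} w] + ∑ (-1)^{deg w₍₁₎} [w₍₁₎ | w₍₂₎]`. -/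
def dvalT (p q : ℕ) : (A p ⊗[R] B q) →ₗ[R] Om A CA B CB :=
  - linT1 A CA B CB p q - linT2 A CA B CB p q + quadT A CA B CB p q

end CobarValuesT

section SpanningWords

variable {R : Type} [CommRing R]

theorem span_range_prod_ι_eq_top {M L : Type} [AddCommGroup M] [Module R M] (f : L → M)
    (hf : Submodule.span R (Set.range f) = ⊤) :
    Submodule.span R (Set.range fun l : List L => (l.map fun t => TensorAlgebra.ι R (f t)).prod)
      = ⊤ := by
  have hgen : Algebra.adjoin R (Set.range fun t => TensorAlgebra.ι R (f t)) = ⊤ := by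
    rw [eq_top_iff, ← TensorAlgebra.adjoin_range_ι, Algebra.adjoin_le_iff]
    rintro _ ⟨m, rfl⟩
    have hm : m ∈ Submodule.span R (Set.range f) := hf ▸ Submodule.mem_top
    induction hm using Submodule.span_induction with
    | mem x hx =>
      obtain ⟨t, rfl⟩ := hx
      exact Algebra.subset_adjoin ⟨t, rfl⟩
    | zero => rw [map_zero]; exact zero_mem _
    | add x y _ _ hx hy => rw [map_add]; exact add_mem hx hy
    | smul r x _ hx => rw [map_smul]; exact Subalgebra.smul_mem _ hx r
  rw [eq_top_iff, ← Algebra.top_toSubmodule, ← hgen, Algebra.adjoin_eq_span]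
  refine Submodule.span_mono fun x hx => ?_
  induction hx using Submonoid.closure_induction with
  | mem x hx =>
    obtain ⟨t, rfl⟩ := hx
    exact ⟨[t], by simp⟩
  | one => exact ⟨[], rfl⟩
  | mul x y _ _ hx hy =>
    obtain ⟨l, rfl⟩ := hx
    obtain ⟨l', rfl⟩ := hy
    exact ⟨l ++ l', by simp⟩

variable (A : ℕ → Type) [∀ n, AddCommGroup (A n)] [∀ n, Module R (A n)] (CA : CoalgStr R A)

theorem toRed_surjective_on_ker (n : ℕ) (x : redT A CA n) :
    ∃ a : A n, toRed A CA n a = x ∧ epsAt A CA n a = 0 := by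
  cases n with
  | zero =>
    obtain ⟨a, ha⟩ := x
    refine ⟨a, Subtype.ext ?_, ha⟩
    have : CA.counit a = 0 := ha
    change a - CA.coaug (CA.counit a) = a
    rw [this, map_zero, sub_zero]
  | succ n => exact ⟨x, rfl, rfl⟩

theorem embT_coaug : embT A CA 0 (CA.coaug 1) = 0 := by
  have : toRed A CA 0 (CA.coaug 1) = 0 := Subtype.ext <| by
    change CA.coaug 1 - CA.coaug (CA.counit (CA.coaug 1)) = 0
    rw [CA.counit_coaug, sub_self]
  simp [embT, this]

/-- `Ā` is spanned by the homogeneous elements of augmentation zero. -/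
theorem big_induction {p : Big A CA → Prop} (h0 : p 0)
    (hadd : ∀ x y, p x → p y → p (x + y))
    (hof : ∀ (n : ℕ) (a : A n), epsAt A CA n a = 0 → p (embT A CA n a)) (x : Big A CA) : p x := by
  induction x using DirectSum.induction_on with
  | zero => exact h0
  | of n x =>
    obtain ⟨a, rfl, ha⟩ := toRed_surjective_on_ker A CA n x
    exact hof n a ha
  | add x y hx hy => exact hadd x y hx hy

theorem span_range_embT :
    Submodule.span R (Set.range fun t : (p : ℕ) × A p => embT A CA t.1 t.2) = ⊤ := by
  refine eq_top_iff.2 fun x _ => ?_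
  induction x using big_induction with
  | h0 => exact zero_mem _
  | hadd x y hx hy => exact add_mem (hx trivial) (hy trivial)
  | hof n a _ => exact Submodule.subset_span ⟨⟨n, a⟩, rfl⟩

theorem span_range_wordAlg : Submodule.span R (Set.range (wordAlg A CA)) = ⊤ :=
  span_range_prod_ι_eq_top _ (span_range_embT A CA)

variable (B : ℕ → Type) [∀ n, AddCommGroup (B n)] [∀ n, Module R (B n)] (CB : CoalgStr R B)

theorem span_range_Γg :
    Submodule.span R (Set.range fun t : (pq : ℕ × ℕ) × (A pq.1 ⊗[R] B pq.2) =>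
      Γg A CA B CB t.1.1 t.1.2 t.2) = ⊤ := by
  set S := Submodule.span R (Set.range fun t : (pq : ℕ × ℕ) × (A pq.1 ⊗[R] B pq.2) =>
    Γg A CA B CB t.1.1 t.1.2 t.2)
  have hmem (p q : ℕ) (a : A p) (b : B q) : Γg A CA B CB p q (a ⊗ₜ b) ∈ S :=
    Submodule.subset_span ⟨⟨(p, q), a ⊗ₜ b⟩, rfl⟩
  have hT (t : Big A CA ⊗[R] Big B CB) : lT A CA B CB t ∈ S := by
    induction t using TensorProduct.induction_on with
    | zero => rw [map_zero]; exact zero_mem _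
    | add x y hx hy => rw [map_add]; exact add_mem hx hy
    | tmul x y =>
      induction x using big_induction with
      | h0 => rw [TensorProduct.zero_tmul, map_zero]; exact zero_mem _
      | hadd x x' hx hx' => rw [TensorProduct.add_tmul, map_add]; exact add_mem hx hx'
      | hof p a ha =>
        induction y using big_induction with
        | h0 => rw [TensorProduct.tmul_zero, map_zero]; exact zero_mem _
        | hadd y y' hy hy' => rw [TensorProduct.tmul_add, map_add]; exact add_mem hy hy'
        | hof q b hb =>
          convert hmem p q a b using 1
          simp [lT, Γg, ha, hb, Prod.zero_eq_mk]
  have hA (x : Big A CA) : lA A CA B CB x ∈ S := by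
    induction x using big_induction with
    | h0 => rw [map_zero]; exact zero_mem _
    | hadd x y hx hy => rw [map_add]; exact add_mem hx hy
    | hof p a ha =>
      convert hmem p 0 a (CB.coaug 1) using 1
      simp [lA, Γg, embT_coaug, epsAt, CB.counit_coaug]
  have hB (y : Big B CB) : lB A CA B CB y ∈ S := by
    induction y using big_induction with
    | h0 => rw [map_zero]; exact zero_mem _
    | hadd x y hx hy => rw [map_add]; exact add_mem hx hy
    | hof q b hb =>
      convert hmem 0 q (CA.coaug 1) b using 1
      simp [lB, Γg, embT_coaug, epsAt, CA.counit_coaug]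
  refine eq_top_iff.2 fun x _ => ?_
  obtain ⟨t, x, y⟩ := x
  convert add_mem (hT t) (add_mem (hA x) (hB y)) using 1
  simp [lT, lA, lB]

theorem span_range_wordW : Submodule.span R (Set.range (wordW A CA B CB)) = ⊤ :=
  span_range_prod_ι_eq_top _ (span_range_Γg A CA B CB)

theorem genW_eq (p q : ℕ) (z : A p ⊗[R] B q) :
    ∃ (t : Big A CA ⊗[R] Big B CB) (a : A p) (b : B q),
      genW A CA B CB p q z = genT A CA B CB t + genA A CA B CB (embT A CA p a)
        + genB A CA B CB (embT B CB q b) := by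
  refine ⟨TensorProduct.map (embT A CA p) (embT B CB q) z,
    TensorProduct.rid R (A p) (TensorProduct.map LinearMap.id (epsAt B CB q) z),
    TensorProduct.lid R (B q) (TensorProduct.map (epsAt A CA p) LinearMap.id z), ?_⟩
  simp only [genW, genT, genA, genB, ← map_add]
  congr 1
  simp [Γg, lT, lA, lB]

theorem OiA_wordAlg (α : List ((p : ℕ) × A p)) :
    OiA A CA B CB (wordAlg A CA α) = wordA A CA B CB α := by
  simp [OiA, wordAlg, wordA, genA, map_list_prod, Function.comp_def]

theorem OiB_wordAlg (β : List ((q : ℕ) × B q)) :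
    OiB A CA B CB (wordAlg B CB β) = wordB A CA B CB β := by
  simp [OiB, wordAlg, wordB, genB, map_list_prod, Function.comp_def]

theorem linearMap_comp_sigmaMil_eq_zero {h : Om A CA B CB →ₗ[R] Om A CA B CB}
    (hzero : ∀ (α : List ((p : ℕ) × A p)) (β : List ((r : ℕ) × B r)),
      h (wordA A CA B CB α * wordB A CA B CB β) = 0) :
    h ∘ₗ sigmaMil A CA B CB = 0 := by
  refine TensorProduct.ext ?_
  refine LinearMap.ext_on_range (span_range_wordAlg A CA) fun α => ?_
  refine LinearMap.ext_on_range (span_range_wordAlg B CB) fun β => ?_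
  simpa [sigmaMil, OiA_wordAlg, OiB_wordAlg] using hzero α β

theorem qMil_genT (t : Big A CA ⊗[R] Big B CB) : qMil A CA B CB (genT A CA B CB t) = 0 := by
  simp [qMil, genT, qgen, lT]

/-- The span of the words `[ω|ab|α]` with `α` a word of letters from `Ā`. -/
def spanTA : Submodule R (Om A CA B CB) :=
  Submodule.span R {x | ∃ u t α, x = u * genT A CA B CB t * wordA A CA B CB α}

/-- The span of the words `[ω|ab|α|β]` with `α` a word of letters from `Ā` and `β` a word of
letters from `B̄`. -/
def spanTAB : Submodule R (Om A CA B CB) :=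
  Submodule.span R {x | ∃ u t α β,
    x = u * genT A CA B CB t * wordA A CA B CB α * wordB A CA B CB β}

variable {A CA B CB}

theorem mul_genT_mem_spanTA (u : Om A CA B CB) (t : Big A CA ⊗[R] Big B CB) :
    u * genT A CA B CB t ∈ spanTA A CA B CB :=
  Submodule.subset_span ⟨u, t, [], by simp [wordA]⟩

theorem mul_genA_mem_spanTA {x : Om A CA B CB} (hx : x ∈ spanTA A CA B CB) (p : ℕ) (a : A p) :
    x * genA A CA B CB (embT A CA p a) ∈ spanTA A CA B CB := by
  induction hx using Submodule.span_induction with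
  | mem x hx =>
    obtain ⟨u, t, α, rfl⟩ := hx
    exact Submodule.subset_span ⟨u, t, α ++ [⟨p, a⟩], by simp [wordA, mul_assoc]⟩
  | zero => rw [zero_mul]; exact zero_mem _
  | add x y _ _ hx hy => rw [add_mul]; exact add_mem hx hy
  | smul r x _ hx => rw [smul_mul_assoc]; exact Submodule.smul_mem _ r hx

theorem mul_mul_wordB_mem_spanTAB {x : Om A CA B CB} (hx : x ∈ spanTA A CA B CB)
    (ω : Om A CA B CB) (β : List ((q : ℕ) × B q)) :
    ω * x * wordB A CA B CB β ∈ spanTAB A CA B CB := by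
  induction hx using Submodule.span_induction with
  | mem x hx =>
    obtain ⟨u, t, α, rfl⟩ := hx
    exact Submodule.subset_span ⟨ω * u, t, α, β, by simp only [mul_assoc]⟩
  | zero => rw [mul_zero, zero_mul]; exact zero_mem _
  | add x y _ _ hx hy => rw [mul_add, add_mul]; exact add_mem hx hy
  | smul r x _ hx => rw [mul_smul_comm, smul_mul_assoc]; exact Submodule.smul_mem _ r hx

theorem sweedC_mem_spanTA (h : Om A CA B CB →ₗ[R] Om A CA B CB) (α : List ((p : ℕ) × A p))
    (x : Big A CA) (t : Big B CB ⊗[R] Big B CB) :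
    sweedC A CA B CB h α x t ∈ spanTA A CA B CB := by
  induction t using TensorProduct.induction_on with
  | zero => rw [map_zero]; exact zero_mem _
  | add s t hs ht => rw [map_add]; exact add_mem hs ht
  | tmul y z => exact mul_genT_mem_spanTA _ _

theorem qMil_eq_zero_of_mem_spanTAB {x : Om A CA B CB} (hx : x ∈ spanTAB A CA B CB) :
    qMil A CA B CB x = 0 := by
  induction hx using Submodule.span_induction with
  | mem x hx =>
    obtain ⟨u, t, α, β, rfl⟩ := hx
    simp [qMil_genT]
  | zero => exact map_zero _
  | add x y _ _ hx hy => rw [map_add, hx, hy, add_zero]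
  | smul r x _ hx => rw [map_smul, hx, smul_zero]

end SpanningWords

/-- Let `A`, `B` be coaugmented chain coalgebras over a commutative
ring `R`.  The natural homotopy `h` on `Ω (A ⊗ B)` (here characterized by its signed
defining recursion on words) satisfies the side conditions
`q h = 0`, `h σ = 0` and `h² = 0`, where `q` is the Milgram map and `σ` its natural
section. -/
theorem homotopy_side_conditions
    (R : Type) [CommRing R]
    (A : ℕ → Type) [∀ n, AddCommGroup (A n)] [∀ n, Module R (A n)] (CA : CoalgStr R A)
    (B : ℕ → Type) [∀ n, AddCommGroup (B n)] [∀ n, Module R (B n)] (CB : CoalgStr R B)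
    -- the natural homotopy h, characterized by its signed defining recursion
    (h : Om A CA B CB →ₗ[R] Om A CA B CB)
    (hh1 : h 1 = 0)
    (hhEnd : ∀ (u : Om A CA B CB) (t : Big A CA ⊗[R] Big B CB), h (u * genT A CA B CB t) = 0)
    (hhBase : ∀ (p q : ℕ) (a : A p) (b : B q),
      h (genB A CA B CB (embT B CB q b) * genA A CA B CB (embT A CA p a))
        = (-((-1 : ℤ)^((p+1)*q))) • genT A CA B CB (embT A CA p a ⊗ₜ[R] embT B CB q b))
    (hhRec1 : ∀ (q : ℕ) (b : B q) (α : List ((p : ℕ) × A p)) (p : ℕ) (a : A p),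
      h (genB A CA B CB (embT B CB q b) * wordA A CA B CB α * genA A CA B CB (embT A CA p a))
        = (-((-1 : ℤ)^(q * (degA A α + p + 1)))) •
            (wordA A CA B CB α * genT A CA B CB (embT A CA p a ⊗ₜ[R] embT B CB q b))
          + h (genB A CA B CB (embT B CB q b) * wordA A CA B CB α) * genA A CA B CB (embT A CA p a)
          - ∑ k : Fin (q+1), ((-1 : ℤ)^((q - k.1) * (degA A α + p + 1))) •
              sweedC A CA B CB h α (embT A CA p a)
                ((TensorProduct.map (embT B CB k.1) (embT B CB (q - k.1)))
                  ((CB.comul k.1 (q - k.1))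
                    (pcast (R := R) (A := B) (by have := k.is_le; omega) b))))
    (hhRec2 : ∀ (lw : List ((pq : ℕ × ℕ) × (A pq.1 ⊗[R] B pq.2))) (q : ℕ) (b : B q)
        (α : List ((p : ℕ) × A p)), α ≠ [] → ∀ β : List ((r : ℕ) × B r),
      h (wordW A CA B CB lw * genB A CA B CB (embT B CB q b) * wordA A CA B CB α * wordB A CA B CB β)
        = ((-1 : ℤ)^(degW A B lw)) •
            (wordW A CA B CB lw * h (genB A CA B CB (embT B CB q b) * wordA A CA B CB α) * wordB A CA B CB β)
          + ((-1 : ℤ)^(degA A α * (q+1))) •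
              h (wordW A CA B CB lw * wordA A CA B CB α * genB A CA B CB (embT B CB q b) * wordB A CA B CB β))
    (hhZero1 : ∀ (α : List ((p : ℕ) × A p)) (β : List ((r : ℕ) × B r)),
      h (wordA A CA B CB α * wordB A CA B CB β) = 0)
    (hhZero2 : ∀ (ω : Om A CA B CB) (t : Big A CA ⊗[R] Big B CB)
        (α : List ((p : ℕ) × A p)) (β : List ((r : ℕ) × B r)),
      h (ω * genT A CA B CB t * wordA A CA B CB α * wordB A CA B CB β) = 0) :
    (qMil A CA B CB).toLinearMap ∘ₗ h = 0 ∧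
    h ∘ₗ sigmaMil A CA B CB = 0 ∧
    h ∘ₗ h = 0 := by
  have hBA (q : ℕ) (b : B q) (α : List ((p : ℕ) × A p)) :
      h (genB A CA B CB (embT B CB q b) * wordA A CA B CB α) ∈ spanTA A CA B CB := by
    induction α using List.reverseRecOn with
    | nil =>
      have h0 := hhZero1 [] [⟨q, b⟩]
      simp only [wordA, wordB, List.map_nil, List.prod_nil, List.map_cons, List.prod_cons,
        one_mul, mul_one] at h0 ⊢
      rw [h0]
      exact zero_mem _
    | append_singleton α a ih =>
      have hw : wordA A CA B CB (α ++ [a])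
          = wordA A CA B CB α * genA A CA B CB (embT A CA a.1 a.2) := by simp [wordA]
      rw [hw, ← mul_assoc, hhRec1]
      refine sub_mem (add_mem (zsmul_mem (mul_genT_mem_spanTA _ _) _)
        (mul_genA_mem_spanTA ih _ _)) (sum_mem fun k _ => zsmul_mem ?_ _)
      exact sweedC_mem_spanTA _ _ _ _
  have hgood (lw : List ((pq : ℕ × ℕ) × (A pq.1 ⊗[R] B pq.2))) :
      ∀ (α : List ((p : ℕ) × A p)) (β : List ((r : ℕ) × B r)),
        h (wordW A CA B CB lw * wordA A CA B CB α * wordB A CA B CB β)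
          ∈ spanTAB A CA B CB := by
    induction lw using List.reverseRecOn with
    | nil =>
      intro α β
      simp only [wordW, List.map_nil, List.prod_nil, one_mul, hhZero1]
      exact zero_mem _
    | append_singleton lw z ih =>
      intro α β
      have hw : wordW A CA B CB (lw ++ [z])
          = wordW A CA B CB lw * genW A CA B CB z.1.1 z.1.2 z.2 := by simp [wordW]
      obtain ⟨t, a, b, hz⟩ := genW_eq A CA B CB z.1.1 z.1.2 z.2
      rw [hw, hz]
      simp only [mul_add, add_mul, map_add]
      refine add_mem (add_mem ?_ ?_) ?_
      · rw [hhZero2]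
        exact zero_mem _
      · have := ih (⟨z.1.1, a⟩ :: α) β
        simpa [wordA, mul_assoc] using this
      · by_cases hα : α = []
        · have := ih [] (⟨z.1.2, b⟩ :: β)
          simpa [hα, wordA, wordB, mul_assoc] using this
        · rw [hhRec2 lw z.1.2 b α hα β]
          refine add_mem (zsmul_mem (mul_mul_wordB_mem_spanTAB (hBA _ b α) _ β) _)
            (zsmul_mem ?_ _)
          have := ih α (⟨z.1.2, b⟩ :: β)
          simpa [wordB, mul_assoc] using this
  have hrange (x : Om A CA B CB) : h x ∈ spanTAB A CA B CB := by
    have hx : x ∈ Submodule.span R (Set.range (wordW A CA B CB)) :=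
      span_range_wordW A CA B CB ▸ Submodule.mem_top
    refine Submodule.span_le (p := (spanTAB A CA B CB).comap h) |>.2 ?_ hx
    rintro _ ⟨lw, rfl⟩
    simpa [wordA, wordB] using hgood lw [] []
  have hkill : spanTAB A CA B CB ≤ LinearMap.ker h := by
    refine Submodule.span_le.2 ?_
    rintro _ ⟨u, t, α, β, rfl⟩
    exact hhZero2 u t α β
  exact ⟨LinearMap.ext fun x => qMil_eq_zero_of_mem_spanTAB (hrange x),
    linearMap_comp_sigmaMil_eq_zero A CA B CB hhZero1, LinearMap.ext fun x => hkill (hrange x)⟩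

end CJ2
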